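/- arXiv:1212.1884 — 2 statements merged into one kernel-verified Lean document; each statement's English description precedes it below -/
import Mathlib

section
/- Fix integers n ≥ 2 and m ≥ 2 and consider the n-player game in which each player has strategy set {0,1,…,m−1} and every player's utility is u_i(x) = 0 if x is the all-zero profile and u_i(x) = −1 otherwise (this game has dominant strategy 0 for every player and is a potential game with potential Φ(x) = −u_1(x)). Then for every β > ln(m^n − 1), the logit dynamics with inverse noise β satisfies: for every integer t < (m^n − 1)/(4(m−1)), there exists a starting profile x with ‖P^t(x,·) − π‖_TV > 1/4; in particular t_mix(1/4) > (m^n − 1)/(4(m−1)) = Ω(m^{n−1}). -/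
noncomputable section

open Finset

variable {n : ℕ} {S : Fin n → Type*} [∀ i, Fintype (S i)] [∀ i, DecidableEq (S i)]
  [∀ i, Nonempty (S i)]

/-- Logit update probability `σ_i(z ∣ x)` with inverse noise `β` for the game with
utilities `u`. -/
def logitSigma (β : ℝ) (u : Fin n → (∀ i, S i) → ℝ) (i : Fin n) (z : S i)
    (x : ∀ i, S i) : ℝ :=
  Real.exp (β * u i (Function.update x i z)) /
    ∑ w : S i, Real.exp (β * u i (Function.update x i w))

/-- Transition matrix of the logit dynamics with inverse noise `β`:
`P x y = (1/n) · σ_i(y_i ∣ x)` if `x` and `y` differ exactly in coordinate `i`,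
`P x x = (1/n) · ∑ i, σ_i(x_i ∣ x)`, and `P x y = 0` otherwise. -/
def logitP (β : ℝ) (u : Fin n → (∀ i, S i) → ℝ) :
    Matrix (∀ i, S i) (∀ i, S i) ℝ := fun x y =>
  (1 / (n : ℝ)) *
    ∑ i, if y = Function.update x i (y i) then logitSigma β u i (y i) x else 0

/-- `Φ` is an (exact) potential for the game with utilities `u`. -/
def IsPotential (u : Fin n → (∀ i, S i) → ℝ) (Φ : (∀ i, S i) → ℝ) : Prop :=
  ∀ (i : Fin n) (a b : S i) (x : ∀ i, S i),
    u i (Function.update x i a) - u i (Function.update x i b) =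
      Φ (Function.update x i b) - Φ (Function.update x i a)

/-- The Gibbs measure `π(x) = exp(−β·Φ(x))/Z`. -/
def gibbs (β : ℝ) (Φ : (∀ i, S i) → ℝ) (x : ∀ i, S i) : ℝ :=
  Real.exp (-β * Φ x) / ∑ y : ∀ i, S i, Real.exp (-β * Φ y)

/-- Total variation distance `(1/2)·∑ z, |μ z − ν z|`. -/
def tvDist {α : Type*} [Fintype α] (μ ν : α → ℝ) : ℝ :=
  (1 / 2) * ∑ z, |μ z - ν z|

/-- Maximum global variation `ΔΦ = max Φ − min Φ`. -/
def maxVar (Φ : (∀ i, S i) → ℝ) : ℝ :=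
  sSup {d : ℝ | ∃ x y : ∀ i, S i, d = Φ x - Φ y}

/-- Two profiles are adjacent if they differ in exactly one coordinate. -/
def Adjacent (x y : ∀ i, S i) : Prop :=
  (Finset.univ.filter fun i => x i ≠ y i).card = 1

/-- Maximum local variation `δΦ`. -/
def localVar (Φ : (∀ i, S i) → ℝ) : ℝ :=
  sSup {d : ℝ | ∃ x y : ∀ i, S i, Adjacent x y ∧ d = Φ x - Φ y}

set_option linter.unusedSectionVars false

/-- Detailed balance passes to powers of a matrix. -/
lemma Matrix.pow_detailed_balance {α : Type*} [Fintype α] [DecidableEq α] {P : Matrix α α ℝ}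
    {w : α → ℝ} (h : ∀ x y, w x * P x y = w y * P y x) (t : ℕ) (x y : α) :
    w x * (P ^ t) x y = w y * (P ^ t) y x := by
  induction t generalizing x y with
  | zero =>
    by_cases hxy : x = y
    · rw [hxy]
    · simp [Matrix.one_apply_ne hxy, Matrix.one_apply_ne (Ne.symm hxy)]
  | succ t ih =>
    rw [pow_succ, Matrix.mul_apply, ← pow_succ, pow_succ', Matrix.mul_apply, Finset.mul_sum,
      Finset.mul_sum]
    refine Finset.sum_congr rfl fun z _ => ?_
    linear_combination P z y * ih x z + (P ^ t) z x * h z y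

lemma Matrix.pow_apply_self_le {α : Type*} [Fintype α] [DecidableEq α] {P : Matrix α α ℝ}
    (hP : P ∈ Matrix.rowStochastic ℝ α) (t : ℕ) (x : α) : P x x ^ t ≤ (P ^ t) x x := by
  have hnn : ∀ (s : ℕ) (a b : α), 0 ≤ (P ^ s) a b := fun s =>
    (Matrix.mem_rowStochastic.1 (pow_mem hP s)).1
  induction t with
  | zero => simp
  | succ t ih =>
    rw [pow_succ, pow_succ, Matrix.mul_apply]
    refine (mul_le_mul_of_nonneg_right ih ((Matrix.mem_rowStochastic.1 hP).1 x x)).trans ?_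
    exact Finset.single_le_sum
      (fun z _ => mul_nonneg (hnn t x z) ((Matrix.mem_rowStochastic.1 hP).1 z x))
      (Finset.mem_univ x)

lemma sub_le_tvDist {α : Type*} [Fintype α] {μ ν : α → ℝ} (h : ∑ z, μ z = ∑ z, ν z) (a : α) :
    ν a - μ a ≤ tvDist μ ν := by
  classical
  have hs : ∑ z, (μ z - ν z) = 0 := by rw [Finset.sum_sub_distrib, h, sub_self]
  rw [← Finset.add_sum_erase _ _ (Finset.mem_univ a)] at hs
  have hle := Finset.abs_sum_le_sum_abs (fun z => μ z - ν z) (Finset.univ.erase a)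
  have h1 := le_abs_self (∑ z ∈ Finset.univ.erase a, (μ z - ν z))
  have h2 := neg_abs_le (μ a - ν a)
  unfold tvDist
  rw [← Finset.add_sum_erase _ _ (Finset.mem_univ a)]
  linarith

lemma logitSigma_nonneg (β : ℝ) (u : Fin n → (∀ i, S i) → ℝ) (i : Fin n) (z : S i)
    (x : ∀ i, S i) : 0 ≤ logitSigma β u i z x := by
  unfold logitSigma
  positivity

lemma sum_logitSigma (β : ℝ) (u : Fin n → (∀ i, S i) → ℝ) (i : Fin n) (x : ∀ i, S i) :
    ∑ z, logitSigma β u i z x = 1 := by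
  have hpos : 0 < ∑ w : S i, Real.exp (β * u i (Function.update x i w)) :=
    Finset.sum_pos (fun _ _ => Real.exp_pos _) Finset.univ_nonempty
  unfold logitSigma
  rw [← Finset.sum_div, div_self hpos.ne']

lemma sum_ite_eq_update (x : ∀ i, S i) (i : Fin n) (f : S i → ℝ) :
    ∑ y : ∀ i, S i, (if y = Function.update x i (y i) then f (y i) else 0) = ∑ z, f z := by
  rw [← Finset.sum_filter]
  refine Finset.sum_bij' (fun y _ => y i) (fun z _ => Function.update x i z) ?_ ?_ ?_ ?_ ?_
  · simp
  · simp
  · intro y hy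
    exact (Finset.mem_filter.1 hy).2.symm
  · simp
  · simp

lemma logitP_mem_rowStochastic (hn : n ≠ 0) (β : ℝ) (u : Fin n → (∀ i, S i) → ℝ) :
    logitP β u ∈ Matrix.rowStochastic ℝ (∀ i, S i) := by
  refine Matrix.mem_rowStochastic_iff_sum.2 ⟨fun x y => ?_, fun x => ?_⟩
  · refine mul_nonneg (by positivity) (Finset.sum_nonneg fun i _ => ?_)
    split_ifs
    exacts [logitSigma_nonneg β u i _ x, le_rfl]
  · simp only [logitP]
    rw [← Finset.mul_sum, Finset.sum_comm]
    have hi : ∀ i, ∑ y : ∀ i, S i,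
        (if y = Function.update x i (y i) then logitSigma β u i (y i) x else 0) = 1 :=
      fun i => (sum_ite_eq_update x i fun z => logitSigma β u i z x).trans
        (sum_logitSigma β u i x)
    simp only [hi]
    simp [hn]

/-- The logit dynamics of a potential game is reversible with respect to the Gibbs weights. -/
lemma logitP_detailed_balance {u : Fin n → (∀ i, S i) → ℝ} {Φ : (∀ i, S i) → ℝ}
    (h : IsPotential u Φ) (β : ℝ) (x y : ∀ i, S i) :
    Real.exp (-β * Φ x) * logitP β u x y = Real.exp (-β * Φ y) * logitP β u y x := by
  unfold logitP
  rw [mul_left_comm, mul_left_comm (Real.exp (-β * Φ y))]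
  congr 1
  rw [Finset.mul_sum, Finset.mul_sum]
  refine Finset.sum_congr rfl fun i _ => ?_
  by_cases hy : y = Function.update x i (y i)
  · have hu : ∀ w, Function.update y i w = Function.update x i w := fun w => by
      rw [hy, Function.update_idem]
    have hx : x = Function.update y i (x i) := by rw [hu, Function.update_eq_self]
    rw [if_pos hy, if_pos hx]
    unfold logitSigma
    simp only [hu]
    rw [mul_div_assoc', mul_div_assoc', ← Real.exp_add, ← Real.exp_add]
    have hp := h i (y i) (x i) x
    rw [← hy, Function.update_eq_self] at hp
    rw [← hy, Function.update_eq_self]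
    congr 2
    linear_combination β * hp
  · have hx : ¬ x = Function.update y i (x i) := fun hx => hy <| by
      rw [hx, Function.update_idem, Function.update_eq_self]
    rw [if_neg hy, if_neg hx, mul_zero, mul_zero]

lemma sum_gibbs (β : ℝ) (Φ : (∀ i, S i) → ℝ) : ∑ x, gibbs β Φ x = 1 := by
  have hpos : 0 < ∑ y : ∀ i, S i, Real.exp (-β * Φ y) :=
    Finset.sum_pos (fun _ _ => Real.exp_pos _) Finset.univ_nonempty
  unfold gibbs
  rw [← Finset.sum_div, div_self hpos.ne']

/-- For the `n`-player game in which each player has strategy set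
`{0,…,m−1}`, utility `0` on the all-zero profile and `−1` elsewhere (a game with
dominant strategy `0` and potential `Φ(x) = −u_1(x)`), for every `β > ln(m^n − 1)`:
for every integer `t < (m^n − 1)/(4(m−1))` there is a starting profile from which the
logit dynamics at time `t` is at total variation distance more than `1/4` from the
Gibbs measure; in particular `t_mix(1/4) > (m^n − 1)/(4(m−1)) = Ω(m^{n−1})`. -/
theorem dominant_strategies_mixing_lower_bound
    (n m : ℕ) (hn : 2 ≤ n) (hm : 2 ≤ m)
    (u : Fin n → (Fin n → Fin m) → ℝ)
    (hu : ∀ i x, u i x = if (∀ j, (x j : ℕ) = 0) then 0 else -1)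
    (Φ : (Fin n → Fin m) → ℝ)
    (hΦ : ∀ x, Φ x = if (∀ j, (x j : ℕ) = 0) then 0 else 1)
    (β : ℝ) (hβ : Real.log ((m : ℝ) ^ n - 1) < β) :
    ∀ t : ℕ, (t : ℝ) < ((m : ℝ) ^ n - 1) / (4 * ((m : ℝ) - 1)) →
      ∃ x : Fin n → Fin m,
        tvDist ((logitP β u ^ t) x) (gibbs β Φ) > 1 / 4 := by
  intro t ht
  have : NeZero m := ⟨by omega⟩
  have hz : ∀ x : Fin n → Fin m, (∀ j, (x j : ℕ) = 0) ↔ x = 0 := fun x => by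
    simp only [funext_iff, Fin.val_eq_zero_iff, Pi.zero_apply]
  simp only [hz] at hu hΦ
  have hpot : IsPotential u Φ := fun i a b x => by
    simp only [hu, hΦ]
    split_ifs <;> norm_num
  have hP := logitP_mem_rowStochastic (by omega) β u
  have hPt := pow_mem hP t
  have hrow := (Matrix.mem_rowStochastic_iff_sum.1 hPt).2
  have hm1 : (0 : ℝ) < (m : ℝ) - 1 := by
    have : (2 : ℝ) ≤ m := by exact_mod_cast hm
    linarith
  have hN : (0 : ℝ) < (m : ℝ) ^ n - 1 := by
    have := one_lt_pow₀ (show (1 : ℝ) < m by linarith) (show n ≠ 0 by omega)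
    linarith
  set q := Real.exp (-β) with hq
  have hq0 : 0 < q := Real.exp_pos _
  have hqN : ((m : ℝ) ^ n - 1) * q < 1 := by
    rw [hq, Real.exp_neg, ← div_eq_mul_inv, div_lt_one (Real.exp_pos _)]
    exact (Real.log_lt_iff_lt_exp hN).1 hβ
  have hw0 : Real.exp (-β * Φ 0) = 1 := by simp [hΦ]
  have hw : ∀ x, x ≠ 0 → Real.exp (-β * Φ x) = q := fun x hx => by simp [hΦ, hx, hq]
  have hcard : (((Finset.univ : Finset (Fin n → Fin m)).erase 0).card : ℝ) = (m : ℝ) ^ n - 1 := by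
    rw [Finset.cast_card_erase_of_mem (Finset.mem_univ _)]
    simp
  have hpi : 1 / 2 < gibbs β Φ 0 := by
    have hZ : ∑ y, Real.exp (-β * Φ y) = 1 + ((m : ℝ) ^ n - 1) * q := by
      rw [← Finset.add_sum_erase _ _ (Finset.mem_univ 0), hw0,
        Finset.sum_congr rfl fun x hx => hw x (Finset.ne_of_mem_erase hx), Finset.sum_const,
        nsmul_eq_mul, hcard]
    unfold gibbs
    rw [hZ, hw0, div_lt_div_iff₀ two_pos (by positivity)]
    linarith
  have hσ : ∀ i, 1 - ((m : ℝ) - 1) * q ≤ logitSigma β u i 0 0 := fun i => by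
    have hup : ∀ w : Fin m, Function.update (0 : Fin n → Fin m) i w = 0 ↔ w = 0 := fun w =>
      Function.update_eq_iff.trans (by simp)
    have hsum : ∑ w : Fin m, Real.exp (β * u i (Function.update 0 i w))
        = 1 + ((m : ℝ) - 1) * q := by
      rw [← Finset.add_sum_erase _ _ (Finset.mem_univ 0)]
      have he : ∀ w ∈ Finset.univ.erase (0 : Fin m),
          Real.exp (β * u i (Function.update 0 i w)) = q := fun w hw => by
        simp [hu, hup, Finset.ne_of_mem_erase hw, hq]
      rw [Finset.sum_congr rfl he, Finset.sum_const, nsmul_eq_mul,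
        Finset.cast_card_erase_of_mem (Finset.mem_univ _)]
      simp [hu]
    unfold logitSigma
    rw [hsum, le_div_iff₀ (by positivity)]
    simp only [hu, hup, if_true, mul_zero, Real.exp_zero]
    nlinarith [sq_nonneg (((m : ℝ) - 1) * q)]
  have hP00 : 1 - ((m : ℝ) - 1) * q ≤ logitP β u 0 0 := by
    have hn0 : (0 : ℝ) < n := by exact_mod_cast (by omega : 0 < n)
    have hs : ∑ _i : Fin n, (1 - ((m : ℝ) - 1) * q) ≤ ∑ i, logitSigma β u i 0 0 :=
      Finset.sum_le_sum fun i _ => hσ i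
    have hd : logitP β u 0 0 = (1 / (n : ℝ)) * ∑ i, logitSigma β u i 0 0 := by
      simp [logitP]
    rw [hd, one_div, ← div_eq_inv_mul, le_div_iff₀ hn0]
    rw [Finset.sum_const, Finset.card_univ, Fintype.card_fin, nsmul_eq_mul] at hs
    rwa [mul_comm]
  have hret : 1 - t * (((m : ℝ) - 1) * q) ≤ (logitP β u ^ t) 0 0 := by
    refine le_trans ?_ (Matrix.pow_apply_self_le hP t 0)
    have h0 := (Matrix.mem_rowStochastic.1 hP).1 0 0
    have hb := one_add_mul_le_pow (show (-2 : ℝ) ≤ logitP β u 0 0 - 1 by linarith) t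
    rw [add_sub_cancel] at hb
    have ht0 : (0 : ℝ) ≤ t := t.cast_nonneg
    nlinarith [mul_le_mul_of_nonneg_left hP00 ht0]
  have hhit : ∑ x ∈ Finset.univ.erase 0, (logitP β u ^ t) x 0 ≤ t * ((m : ℝ) - 1) := by
    have hrev : ∀ x ∈ Finset.univ.erase (0 : Fin n → Fin m),
        q * (logitP β u ^ t) x 0 = (logitP β u ^ t) 0 x := fun x hx => by
      have h := Matrix.pow_detailed_balance (logitP_detailed_balance hpot β) t x 0
      rwa [hw0, hw x (Finset.ne_of_mem_erase hx), one_mul] at h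
    have h := hrow 0
    rw [← Finset.add_sum_erase _ _ (Finset.mem_univ 0), ← Finset.sum_congr rfl hrev,
      ← Finset.mul_sum] at h
    refine le_of_mul_le_mul_left ?_ hq0
    linarith
  obtain ⟨x, -, hx⟩ : ∃ x ∈ Finset.univ.erase (0 : Fin n → Fin m),
      (logitP β u ^ t) x 0 < 1 / 4 := by
    refine Finset.exists_lt_of_sum_lt (hhit.trans_lt ?_)
    rw [Finset.sum_const, nsmul_eq_mul, hcard]
    rw [lt_div_iff₀ (by positivity)] at ht
    linarith
  refine ⟨x, ?_⟩
  have h := sub_le_tvDist ((hrow x).trans (sum_gibbs β Φ).symm) 0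
  linarith
end
end

section
/- Let 𝒢 be a graphical coordination game on a graph G = (V,E) with V = {1,…,n} and parameters δ₀ ≥ δ₁ > 0, let β ≥ 0, let P be the logit dynamics transition matrix and π the Gibbs measure. For each pair of profiles x, y let Γ_{x,y} be the canonical bit-fixing path from x to y: if i_1 < i_2 < ⋯ < i_d are the coordinates where x and y differ, Γ_{x,y} = (z^0, z^1, …, z^d) with z^0 = x, z^d = y and z^j = (y_1,…,y_{i_j}, x_{i_j+1},…, x_n). Then the congestion ρ = max over ordered pairs (u,v) with u ≠ v and P(u,v) > 0 of (1/(π(u)·P(u,v))) · ∑_{(x,y) : (u,v) is an edge of Γ_{x,y}} π(x)·π(y)·d(x,y) satisfies ρ ≤ 2·n²·e^{χ·(δ₀+δ₁)·β}, where d(x,y) is the Hamming distance and χ = max_{1≤i≤n} |{(j,h) ∈ E : j ≤ i < h}| is the cutwidth of the natural ordering of V. -/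
noncomputable section
open scoped Classical

open Finset

/-- Edge potential of the basic 2×2 coordination game:
`φ(0,0) = −δ₀`, `φ(1,1) = −δ₁`, `φ(0,1) = φ(1,0) = 0`. -/
def coordPhi (δ0 δ1 : ℝ) (a b : Bool) : ℝ :=
  if a = false ∧ b = false then -δ0 else if a = true ∧ b = true then -δ1 else 0

/-- Potential of the graphical coordination game on the (oriented) edge set `E`:
`Φ(x) = ∑_{(u,v) ∈ E} φ(x_u, x_v)`. -/
def graphPot {n : ℕ} (E : Finset (Fin n × Fin n)) (δ0 δ1 : ℝ) (x : Fin n → Bool) : ℝ :=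
  ∑ e ∈ E, coordPhi δ0 δ1 (x e.1) (x e.2)

/-- Gibbs measure `π(x) = exp(−β·Φ(x))/Z` on `{0,1}^n`. -/
def gibbsB {n : ℕ} (β : ℝ) (Φ : (Fin n → Bool) → ℝ) (x : Fin n → Bool) : ℝ :=
  Real.exp (-β * Φ x) / ∑ y : Fin n → Bool, Real.exp (-β * Φ y)

/-- Logit update probability expressed via the potential:
`σ_i(z ∣ x) = exp(−β·Φ(z,x_{−i})) / ∑_{w∈{0,1}} exp(−β·Φ(w,x_{−i}))`. -/
def sigmaB {n : ℕ} (β : ℝ) (Φ : (Fin n → Bool) → ℝ) (i : Fin n) (z : Bool)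
    (x : Fin n → Bool) : ℝ :=
  Real.exp (-β * Φ (Function.update x i z)) /
    ∑ w : Bool, Real.exp (-β * Φ (Function.update x i w))

/-- Transition matrix of the logit dynamics with inverse noise `β` on `{0,1}^n`. -/
def logitPB {n : ℕ} (β : ℝ) (Φ : (Fin n → Bool) → ℝ) :
    Matrix (Fin n → Bool) (Fin n → Bool) ℝ := fun x y =>
  (1 / (n : ℝ)) *
    ∑ i, if y = Function.update x i (y i) then sigmaB β Φ i (y i) x else 0

/-- Hamming distance between two profiles. -/
def hamDist {n : ℕ} (x y : Fin n → Bool) : ℕ :=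
  (Finset.univ.filter fun i => x i ≠ y i).card

/-- `(u,v)` is an edge of the canonical bit-fixing path `Γ_{x,y}` from `x` to `y`
(which corrects the coordinates where `x` and `y` disagree in increasing order):
there is a differing coordinate `i` with `u = (y₁,…,y_{i−1}, x_i,…,x_n)` and
`v = (y₁,…,y_{i−1}, y_i, x_{i+1},…,x_n)`. -/
def pathEdge {n : ℕ} (x y u v : Fin n → Bool) : Prop :=
  ∃ i : Fin n, x i ≠ y i ∧
    u = (fun j => if j < i then y j else x j) ∧
    v = (fun j => if j ≤ i then y j else x j)

/-- The profile that agrees with `x` where `q` holds and with `y` elsewhere. -/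
def mixProfile {n : ℕ} (q : Fin n → Prop) (x y : Fin n → Bool) : Fin n → Bool :=
  fun j => if q j then x j else y j

theorem mixProfile_mixProfile {n : ℕ} (q : Fin n → Prop) (x y : Fin n → Bool) :
    mixProfile q (mixProfile q x y) (mixProfile q y x) = x := by
  funext j
  by_cases h : q j <;> simp [mixProfile, h]

theorem coordPhi_exchange {δ0 δ1 : ℝ} (h0 : 0 ≤ δ0) (h1 : 0 ≤ δ1) (a b c d : Bool) :
    coordPhi δ0 δ1 a d + coordPhi δ0 δ1 c b ≤
      coordPhi δ0 δ1 a b + coordPhi δ0 δ1 c d + (δ0 + δ1) := by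
  cases a <;> cases b <;> cases c <;> cases d <;> simp [coordPhi] <;> linarith

theorem graphPot_exchange {n : ℕ} (E : Finset (Fin n × Fin n)) {δ0 δ1 : ℝ}
    (h0 : 0 ≤ δ0) (h1 : 0 ≤ δ1) {q : Fin n → Prop} (hq : ∀ e ∈ E, q e.2 → q e.1)
    (x y : Fin n → Bool) :
    graphPot E δ0 δ1 (mixProfile q x y) + graphPot E δ0 δ1 (mixProfile q y x) ≤
      graphPot E δ0 δ1 x + graphPot E δ0 δ1 y +
        ((E.filter fun e => q e.1 ∧ ¬ q e.2).card : ℝ) * (δ0 + δ1) := by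
  rw [← nsmul_eq_mul, ← Finset.sum_const, Finset.sum_filter]
  simp only [graphPot, ← Finset.sum_add_distrib]
  refine Finset.sum_le_sum fun e he => ?_
  by_cases ha : q e.1 <;> by_cases hb : q e.2
  · simp [mixProfile, ha, hb]
  · simpa [mixProfile, ha, hb] using
      coordPhi_exchange h0 h1 (x e.1) (x e.2) (y e.1) (y e.2)
  · exact absurd (hq e he hb) ha
  · simp [mixProfile, ha, hb, add_comm]

theorem gibbsB_partition_pos {n : ℕ} (β : ℝ) (Φ : (Fin n → Bool) → ℝ) :
    0 < ∑ y : Fin n → Bool, Real.exp (-β * Φ y) :=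
  Finset.sum_pos (fun _ _ => Real.exp_pos _) Finset.univ_nonempty

theorem gibbsB_pos {n : ℕ} (β : ℝ) (Φ : (Fin n → Bool) → ℝ) (x : Fin n → Bool) :
    0 < gibbsB β Φ x :=
  div_pos (Real.exp_pos _) (gibbsB_partition_pos β Φ)

theorem sum_gibbsB {n : ℕ} (β : ℝ) (Φ : (Fin n → Bool) → ℝ) :
    ∑ x, gibbsB β Φ x = 1 := by
  simp only [gibbsB, ← Finset.sum_div]
  exact div_self (gibbsB_partition_pos β Φ).ne'

theorem gibbsB_mul_le {n : ℕ} {β c : ℝ} (hβ : 0 ≤ β) {Φ : (Fin n → Bool) → ℝ}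
    {x y u w : Fin n → Bool} (h : Φ u + Φ w ≤ Φ x + Φ y + c) :
    gibbsB β Φ x * gibbsB β Φ y ≤ Real.exp (c * β) * gibbsB β Φ u * gibbsB β Φ w := by
  have hZ := gibbsB_partition_pos β Φ
  simp only [gibbsB]
  rw [div_mul_div_comm, mul_assoc, div_mul_div_comm, ← mul_div_assoc]
  refine div_le_div_of_nonneg_right ?_ (by positivity)
  rw [← Real.exp_add, ← Real.exp_add, ← Real.exp_add, Real.exp_le_exp]
  nlinarith [mul_le_mul_of_nonneg_left h hβ]

/-- The complementary mixture `mixProfile q x y` encodes a pair `(x, y)` injectively once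
`mixProfile q y x` is prescribed. -/
theorem sum_gibbsB_mul_le {n : ℕ} (E : Finset (Fin n × Fin n)) {δ0 δ1 β : ℝ}
    (h0 : 0 ≤ δ0) (h1 : 0 ≤ δ1) (hβ : 0 ≤ β) {q : Fin n → Prop}
    (hq : ∀ e ∈ E, q e.2 → q e.1) {k : ℕ}
    (hk : (E.filter fun e => q e.1 ∧ ¬ q e.2).card ≤ k) (u : Fin n → Bool)
    (F : Finset ((Fin n → Bool) × (Fin n → Bool)))
    (hF : ∀ p ∈ F, mixProfile q p.2 p.1 = u) :
    ∑ p ∈ F, gibbsB β (graphPot E δ0 δ1) p.1 * gibbsB β (graphPot E δ0 δ1) p.2 ≤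
      Real.exp ((k : ℝ) * (δ0 + δ1) * β) * gibbsB β (graphPot E δ0 δ1) u := by
  set Φ := graphPot E δ0 δ1
  have hC : 0 ≤ Real.exp ((k : ℝ) * (δ0 + δ1) * β) * gibbsB β Φ u :=
    mul_nonneg (Real.exp_pos _).le (gibbsB_pos β Φ u).le
  have hinj : Set.InjOn (fun p : (Fin n → Bool) × (Fin n → Bool) => mixProfile q p.1 p.2) F := by
    intro p hp p' hp' h
    have hu := hF p hp
    have hu' := hF p' hp'
    refine Prod.ext ?_ ?_
    · rw [← mixProfile_mixProfile q p.1 p.2, ← mixProfile_mixProfile q p'.1 p'.2, hu, hu']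
      exact congrArg (mixProfile q · u) h
    · rw [← mixProfile_mixProfile q p.2 p.1, ← mixProfile_mixProfile q p'.2 p'.1, hu, hu']
      exact congrArg (mixProfile q u ·) h
  calc ∑ p ∈ F, gibbsB β Φ p.1 * gibbsB β Φ p.2
      ≤ ∑ p ∈ F, Real.exp ((k : ℝ) * (δ0 + δ1) * β) * gibbsB β Φ u *
          gibbsB β Φ (mixProfile q p.1 p.2) := by
        refine Finset.sum_le_sum fun p hp => gibbsB_mul_le hβ ?_
        have hex := graphPot_exchange E h0 h1 hq p.1 p.2
        rw [hF p hp] at hex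
        have hk' : ((E.filter fun e => q e.1 ∧ ¬ q e.2).card : ℝ) * (δ0 + δ1) ≤
            (k : ℝ) * (δ0 + δ1) :=
          mul_le_mul_of_nonneg_right (by exact_mod_cast hk) (add_nonneg h0 h1)
        simp only [Φ]
        linarith
    _ = Real.exp ((k : ℝ) * (δ0 + δ1) * β) * gibbsB β Φ u *
          ∑ w ∈ F.image (fun p => mixProfile q p.1 p.2), gibbsB β Φ w := by
        rw [← Finset.mul_sum, Finset.sum_image hinj]
    _ ≤ Real.exp ((k : ℝ) * (δ0 + δ1) * β) * gibbsB β Φ u * 1 := by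
        refine mul_le_mul_of_nonneg_left ?_ hC
        rw [← sum_gibbsB β Φ]
        exact Finset.sum_le_sum_of_subset_of_nonneg (Finset.subset_univ _)
          fun w _ _ => (gibbsB_pos β Φ w).le
    _ = _ := mul_one _

theorem logitPB_of_eq_update {n : ℕ} (β : ℝ) (Φ : (Fin n → Bool) → ℝ)
    {u v : Fin n → Bool} (huv : u ≠ v) {i : Fin n} (hi : v = Function.update u i (v i)) :
    logitPB β Φ u v = 1 / (n : ℝ) * (gibbsB β Φ v / (gibbsB β Φ u + gibbsB β Φ v)) := by
  have hne : u i ≠ v i := by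
    intro h
    exact huv (by rw [hi, ← h, Function.update_eq_self])
  have hsum : ∑ w : Bool, Real.exp (-β * Φ (Function.update u i w)) =
      Real.exp (-β * Φ u) + Real.exp (-β * Φ v) := by
    have hw : (Finset.univ : Finset Bool) = {u i, v i} := by
      ext w
      revert hne
      generalize u i = a
      generalize v i = b
      cases a <;> cases b <;> cases w <;> simp
    rw [hw, Finset.sum_pair hne, ← hi, Function.update_eq_self]
  have hZ := gibbsB_partition_pos β Φ
  unfold logitPB
  rw [Finset.sum_eq_single i]
  · rw [if_pos hi, sigmaB, hsum, ← hi]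
    simp only [gibbsB]
    rw [← add_div, div_div_div_cancel_right₀ hZ.ne']
  · intro j _ hj
    refine if_neg fun h => hne ?_
    have := congrFun h i
    rw [Function.update_of_ne hj.symm] at this
    exact this.symm
  · simp

theorem exists_eq_update_of_logitPB_pos {n : ℕ} {β : ℝ} {Φ : (Fin n → Bool) → ℝ}
    {u v : Fin n → Bool} (h : 0 < logitPB β Φ u v) :
    ∃ i, v = Function.update u i (v i) := by
  by_contra! hno
  simp [logitPB, hno] at h

theorem card_cut_lt_le {n : ℕ} (E : Finset (Fin n × Fin n)) (i : Fin n) :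
    (E.filter fun e => e.1 < i ∧ ¬ e.2 < i).card ≤
      Finset.univ.sup fun i : Fin n => (E.filter fun e => e.1 ≤ i ∧ i < e.2).card := by
  rcases Nat.eq_zero_or_pos i.val with h | h
  · rw [Finset.filter_false_of_mem]
    · simp
    · rintro e - ⟨he, -⟩
      have := Fin.lt_def.1 he
      omega
  · have hlt : i.val - 1 < n := by omega
    refine le_trans (Finset.card_le_card fun e => ?_)
      (Finset.le_sup (f := fun i : Fin n => (E.filter fun e => e.1 ≤ i ∧ i < e.2).card)
        (Finset.mem_univ (⟨i.val - 1, hlt⟩ : Fin n)))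
    simp only [Finset.mem_filter, Fin.lt_def, Fin.le_def]
    rintro ⟨he, h1, h2⟩
    exact ⟨he, by omega, by omega⟩

theorem card_cut_le_le {n : ℕ} (E : Finset (Fin n × Fin n)) (i : Fin n) :
    (E.filter fun e => e.1 ≤ i ∧ ¬ e.2 ≤ i).card ≤
      Finset.univ.sup fun i : Fin n => (E.filter fun e => e.1 ≤ i ∧ i < e.2).card := by
  simp only [not_le]
  exact Finset.le_sup (f := fun i : Fin n => (E.filter fun e => e.1 ≤ i ∧ i < e.2).card)
    (Finset.mem_univ i)

theorem pathEdge.eq_mixProfile {n : ℕ} {x y u v : Fin n → Bool} (h : pathEdge x y u v)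
    {i : Fin n} (hi : v = Function.update u i (v i)) :
    mixProfile (· < i) y x = u ∧ mixProfile (· ≤ i) y x = v := by
  obtain ⟨k, hk, hu, hv⟩ := h
  have hki : k = i := by
    by_contra hne
    have h2 : v k = u k := by
      rw [hi, Function.update_of_ne hne]
    rw [hu, hv] at h2
    simp only [le_refl, lt_irrefl, if_true, if_false] at h2
    exact hk h2.symm
  subst hki
  constructor
  · rw [hu]; funext j; by_cases hj : j < k <;> simp [mixProfile, hj]
  · rw [hv]; funext j; by_cases hj : j ≤ k <;> simp [mixProfile, hj]

/-- Congestion bound for the canonical bit-fixing paths of the logit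
dynamics of a graphical coordination game: for every chain edge `(u,v)` (i.e. `u ≠ v`
with `P(u,v) > 0`),
`(1/(π(u)·P(u,v))) · ∑_{(x,y) : (u,v) ∈ Γ_{x,y}} π(x)·π(y)·d(x,y) ≤ 2·n²·e^{χ·(δ₀+δ₁)·β}`,
where `χ = max_i |{(j,h) ∈ E : j ≤ i < h}|` is the cutwidth of the natural ordering. -/
theorem graphical_coordination_congestion_bound
    (n : ℕ) (hn : 1 ≤ n) (E : Finset (Fin n × Fin n))
    (horient : ∀ e ∈ E, e.1 < e.2)
    (δ0 δ1 : ℝ) (h01 : δ1 ≤ δ0) (h1 : 0 < δ1) (β : ℝ) (hβ : 0 ≤ β) :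
    ∀ u v : Fin n → Bool, u ≠ v → 0 < logitPB β (graphPot E δ0 δ1) u v →
      (1 / (gibbsB β (graphPot E δ0 δ1) u * logitPB β (graphPot E δ0 δ1) u v)) *
          ∑ p ∈ Finset.univ.filter
              (fun p : (Fin n → Bool) × (Fin n → Bool) => pathEdge p.1 p.2 u v),
            gibbsB β (graphPot E δ0 δ1) p.1 * gibbsB β (graphPot E δ0 δ1) p.2 *
              (hamDist p.1 p.2 : ℝ) ≤
        2 * (n : ℝ) ^ 2 *
          Real.exp (((Finset.univ.sup fun i : Fin n =>
              (E.filter fun e => e.1 ≤ i ∧ i < e.2).card : ℕ) : ℝ) * (δ0 + δ1) * β) := by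
  intro u v huv hP
  obtain ⟨i, hi⟩ := exists_eq_update_of_logitPB_pos hP
  rw [logitPB_of_eq_update β _ huv hi]
  have h0 : 0 ≤ δ0 := h1.le.trans h01
  have hn0 : (0 : ℝ) < n := by exact_mod_cast hn
  set χ := Finset.univ.sup fun i : Fin n => (E.filter fun e => e.1 ≤ i ∧ i < e.2).card
  set F := Finset.univ.filter
    fun p : (Fin n → Bool) × (Fin n → Bool) => pathEdge p.1 p.2 u v
  have hF : ∀ p ∈ F, mixProfile (· < i) p.2 p.1 = u ∧ mixProfile (· ≤ i) p.2 p.1 = v :=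
    fun p hp => (Finset.mem_filter.1 hp).2.eq_mixProfile hi
  have hSu := sum_gibbsB_mul_le E h0 h1.le hβ (q := (· < i)) (k := χ)
    (fun e he h => (horient e he).trans h) (by convert card_cut_lt_le E i) u F fun p hp => (hF p hp).1
  have hSv := sum_gibbsB_mul_le E h0 h1.le hβ (q := (· ≤ i)) (k := χ)
    (fun e he h => (horient e he).le.trans h) (by convert card_cut_le_le E i) v F fun p hp => (hF p hp).2
  set Φ := graphPot E δ0 δ1
  set C := Real.exp ((χ : ℝ) * (δ0 + δ1) * β)
  set S := ∑ p ∈ F, gibbsB β Φ p.1 * gibbsB β Φ p.2 with hS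
  have hu := gibbsB_pos β Φ u
  have hv := gibbsB_pos β Φ v
  have hham : ∑ p ∈ F, gibbsB β Φ p.1 * gibbsB β Φ p.2 * (hamDist p.1 p.2 : ℝ) ≤ S * n := by
    rw [hS, Finset.sum_mul]
    refine Finset.sum_le_sum fun p _ => mul_le_mul_of_nonneg_left ?_
      (mul_pos (gibbsB_pos β Φ p.1) (gibbsB_pos β Φ p.2)).le
    exact_mod_cast (Finset.card_le_univ _).trans_eq (Fintype.card_fin n)
  have hinv : 1 / (gibbsB β Φ u * (1 / (n : ℝ) * (gibbsB β Φ v /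
      (gibbsB β Φ u + gibbsB β Φ v)))) = n * (1 / gibbsB β Φ u + 1 / gibbsB β Φ v) := by
    field_simp
    ring
  rw [hinv]
  calc _ ≤ (n : ℝ) * (1 / gibbsB β Φ u + 1 / gibbsB β Φ v) * (S * n) :=
        mul_le_mul_of_nonneg_left hham (by positivity)
    _ = (n : ℝ) ^ 2 * (S / gibbsB β Φ u + S / gibbsB β Φ v) := by ring
    _ ≤ (n : ℝ) ^ 2 * (C + C) := by
        gcongr
        · exact (div_le_iff₀ hu).2 hSu
        · exact (div_le_iff₀ hv).2 hSv
    _ = 2 * (n : ℝ) ^ 2 * C := by ring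
end
end
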